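/- For the incompatible-statistics circuit, all recorded conditional probabilities are Markovian yet mutually incompatible: whenever the respective conditioning probabilities are positive, P(x_4 | x_3, x_2, x_1) = 1/2 if x_3 = 0 (independent of x_2, x_1), P(x_4 | x_3, 𝓘_2, x_1) = 1 if x_3 = 0 and x_4 = 0 and 0 otherwise (independent of x_1), P(x_4 | x_3, x_2, 𝓘_1) = 1/2 if x_3 = 0 (independent of x_2), P(x_3 | x_2, x_1) = P(x_3 | 𝓘_2, x_1) = P(x_3 | x_2, 𝓘_1) = 1 if x_3 = 0 and 0 otherwise; in particular P(x_4 | x_3, x_2, x_1) ≠ P(x_4 | x_3, 𝓘_2, x_1) for x_3 = 0, so the Markovian conditional probabilities at t_4 depend on whether a measurement was performed at t_2. -/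

import Mathlib

open Matrix Kronecker

noncomputable section

/-- Standard-basis projector `|x⟩⟨x|` on a qubit. -/
def proj (x : Fin 2) : Matrix (Fin 2) (Fin 2) ℂ := Matrix.single x x 1

/-- The Hadamard gate `H = (1/√2)·!![1,1;1,-1]`. -/
def Hgate : Matrix (Fin 2) (Fin 2) ℂ := (Real.sqrt 2 : ℂ)⁻¹ • !![1, 1; 1, -1]

/-- Sharp standard-basis measurement of the system qubit (first factor) of a
two-qubit state: `𝒫^x(A) = (|x⟩⟨x| ⊗ 𝟙) A (|x⟩⟨x| ⊗ 𝟙)`. -/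
def measSys (x : Fin 2) (A : Matrix (Fin 2 × Fin 2) (Fin 2 × Fin 2) ℂ) :
    Matrix (Fin 2 × Fin 2) (Fin 2 × Fin 2) ℂ :=
  (proj x ⊗ₖ (1 : Matrix (Fin 2) (Fin 2) ℂ)) * A * (proj x ⊗ₖ (1 : Matrix (Fin 2) (Fin 2) ℂ))

/-- Optionally measure the system qubit: `some x` applies `𝒫^x`, `none` the identity. -/
def optMeasSys (o : Option (Fin 2)) (A : Matrix (Fin 2 × Fin 2) (Fin 2 × Fin 2) ℂ) :
    Matrix (Fin 2 × Fin 2) (Fin 2 × Fin 2) ℂ :=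
  o.elim A fun x => measSys x A

/-- The Hadamard gate applied to the system qubit of a two-qubit state. -/
def Hsys (A : Matrix (Fin 2 × Fin 2) (Fin 2 × Fin 2) ℂ) :
    Matrix (Fin 2 × Fin 2) (Fin 2 × Fin 2) ℂ :=
  (Hgate ⊗ₖ (1 : Matrix (Fin 2) (Fin 2) ℂ)) * A * (Hgate ⊗ₖ (1 : Matrix (Fin 2) (Fin 2) ℂ))ᴴ

/-- The two-qubit CNOT with the system (first factor) as control and the environment
(second factor) as target: `|s,e⟩ ↦ |s, e+s⟩`. -/
def CNOTS : Matrix (Fin 2 × Fin 2) (Fin 2 × Fin 2) ℂ :=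
  Matrix.of fun p q => if p.1 = q.1 ∧ p.2 = q.2 + q.1 then 1 else 0

/-- The two-qubit CNOT with the environment (second factor) as control and the
system (first factor) as target: `|s,e⟩ ↦ |s+e, e⟩`. -/
def CNOTE : Matrix (Fin 2 × Fin 2) (Fin 2 × Fin 2) ℂ :=
  Matrix.of fun p q => if p.2 = q.2 ∧ p.1 = q.1 + q.2 then 1 else 0

/-- The partial trace over the system qubit (first factor) of a two-qubit matrix. -/
def ptraceSys (A : Matrix (Fin 2 × Fin 2) (Fin 2 × Fin 2) ℂ) :
    Matrix (Fin 2) (Fin 2) ℂ :=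
  Matrix.of fun e e' => ∑ s : Fin 2, A (s, e) (s, e')

/-- The initial joint system–environment state `φ = (1/2)(|00⟩⟨00| + |11⟩⟨11|)` of
the incompatible-statistics circuit (Fig. 3). -/
def phi0 : Matrix (Fin 2 × Fin 2) (Fin 2 × Fin 2) ℂ :=
  (1 / 2 : ℂ) • (proj 0 ⊗ₖ proj 0 + proj 1 ⊗ₖ proj 1)

/-- The (subnormalised) system–environment state of the incompatible-statistics
circuit (Fig. 3) immediately before the measurement at `t₃`: start from `φ`,
optionally measure the system (`m₁`), apply `H` on the system, optionally measure
(`m₂`), apply `H` on the system, apply CNOT controlled on the system, then discard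
the system (partial trace) and re-prepare it in `|0⟩⟨0|`. -/
def incPre3 (m1 m2 : Option (Fin 2)) : Matrix (Fin 2 × Fin 2) (Fin 2 × Fin 2) ℂ :=
  let s1 := optMeasSys m1 phi0
  let s2 := Hsys s1
  let s3 := optMeasSys m2 s2
  let s4 := Hsys s3
  let s5 := CNOTS * s4 * CNOTSᴴ
  proj 0 ⊗ₖ ptraceSys s5

/-- The final subnormalised two-qubit state of the incompatible-statistics circuit
(Fig. 3): after `incPre3`, measure the system (`𝒫^{x₃}`), apply CNOT controlled on
the environment, and measure the system (`𝒫^{x₄}`). -/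
def incFinal (m1 m2 : Option (Fin 2)) (x3 x4 : Fin 2) :
    Matrix (Fin 2 × Fin 2) (Fin 2 × Fin 2) ℂ :=
  measSys x4 (CNOTE * measSys x3 (incPre3 m1 m2) * CNOTEᴴ)
/-- Joint probability `P(x₄,x₃,·,·)` (real part of the final trace) for the
incompatible-statistics circuit with measurement pattern `m₁, m₂` at `t₁, t₂`. -/
def incP4 (m1 m2 : Option (Fin 2)) (x3 x4 : Fin 2) : ℝ :=
  (incFinal m1 m2 x3 x4).trace.re

/-- Joint probability `P(x₃,·,·)` for the incompatible-statistics circuit with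
measurement pattern `m₁, m₂` at `t₁, t₂`. -/
def incP3 (m1 m2 : Option (Fin 2)) (x3 : Fin 2) : ℝ :=
  (measSys x3 (incPre3 m1 m2)).trace.re

/-- Joint probability of the outcomes recorded at times `t₁, t₂` (per the pattern
`m₁, m₂`) for the incompatible-statistics circuit. -/
def incP2 (m1 m2 : Option (Fin 2)) : ℝ :=
  (optMeasSys m2 (Hsys (optMeasSys m1 phi0))).trace.re

/-- Entrywise form of the system measurement. -/
lemma measSys_apply (x : Fin 2) (A : Matrix (Fin 2 × Fin 2) (Fin 2 × Fin 2) ℂ)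
    (a b c d : Fin 2) :
    measSys x A (a, b) (c, d) = if a = x ∧ c = x then A (a, b) (c, d) else 0 := by
  fin_cases x <;> fin_cases a <;> fin_cases b <;> fin_cases c <;> fin_cases d <;>
    simp [measSys, proj, Matrix.mul_apply, Fintype.sum_prod_type, Matrix.single_apply,
      Matrix.one_apply]

/-- Sign of the Hadamard entry. -/
def sg (a b : Fin 2) : ℂ := if a = 1 ∧ b = 1 then -1 else 1

lemma Hgate_apply (a b : Fin 2) : Hgate a b = (Real.sqrt 2 : ℂ)⁻¹ * sg a b := by
  fin_cases a <;> fin_cases b <;> simp [Hgate, sg]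

lemma star_Hgate (a b : Fin 2) : star (Hgate a b) = Hgate a b := by
  fin_cases a <;> fin_cases b <;> simp [Hgate]

lemma inv_sqrt_mul : (Real.sqrt 2 : ℂ)⁻¹ * (Real.sqrt 2 : ℂ)⁻¹ = 1 / 2 := by
  rw [← mul_inv, ← Complex.ofReal_mul, Real.mul_self_sqrt (by norm_num)]
  norm_num

/-- Entrywise form of the Hadamard conjugation. -/
lemma Hsys_apply (A : Matrix (Fin 2 × Fin 2) (Fin 2 × Fin 2) ℂ) (a b c d : Fin 2) :
    Hsys A (a, b) (c, d) =
      1 / 2 * ∑ s : Fin 2, ∑ t : Fin 2, sg a s * sg c t * A (s, b) (t, d) := by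
  have h : Hsys A (a, b) (c, d) =
      ∑ s : Fin 2, ∑ t : Fin 2, Hgate a s * Hgate c t * A (s, b) (t, d) := by
    simp only [Hsys, Matrix.mul_apply, Fintype.sum_prod_type, Matrix.conjTranspose_apply,
      Matrix.kroneckerMap_apply, star_mul', star_Hgate]
    fin_cases b <;> fin_cases d <;> simp [Matrix.one_apply] <;> ring
  rw [h, ← inv_sqrt_mul, Finset.mul_sum]
  refine Finset.sum_congr rfl fun s _ => ?_
  rw [Finset.mul_sum]
  refine Finset.sum_congr rfl fun t _ => ?_
  rw [Hgate_apply, Hgate_apply]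
  ring

lemma CNOTS_conj (A : Matrix (Fin 2 × Fin 2) (Fin 2 × Fin 2) ℂ) (a b c d : Fin 2) :
    (CNOTS * A * CNOTSᴴ) (a, b) (c, d) = A (a, b + a) (c, d + c) := by
  fin_cases a <;> fin_cases b <;> fin_cases c <;> fin_cases d <;>
    simp [CNOTS, Matrix.mul_apply, Fintype.sum_prod_type]

lemma CNOTE_conj (A : Matrix (Fin 2 × Fin 2) (Fin 2 × Fin 2) ℂ) (a b c d : Fin 2) :
    (CNOTE * A * CNOTEᴴ) (a, b) (c, d) = A (a + b, b) (c + d, d) := by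
  fin_cases a <;> fin_cases b <;> fin_cases c <;> fin_cases d <;>
    simp [CNOTE, Matrix.mul_apply, Fintype.sum_prod_type]

lemma phi0_apply (a b c d : Fin 2) :
    phi0 (a, b) (c, d) = if a = b ∧ c = d ∧ a = c then 1 / 2 else 0 := by
  fin_cases a <;> fin_cases b <;> fin_cases c <;> fin_cases d <;>
    simp [phi0, proj, Matrix.single_apply]

lemma incPre3_apply (m1 m2 : Option (Fin 2)) (a b c d : Fin 2) :
    incPre3 m1 m2 (a, b) (c, d) = if a = 0 ∧ c = 0 then
      ∑ s : Fin 2, Hsys (optMeasSys m2 (Hsys (optMeasSys m1 phi0))) (s, b + s) (s, d + s)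
      else 0 := by
  simp only [incPre3, Matrix.kroneckerMap_apply, ptraceSys, Matrix.of_apply, CNOTS_conj, proj,
    Matrix.single_apply]
  by_cases ha : a = 0 <;> by_cases hc : c = 0 <;> simp [ha, hc, eq_comm]

lemma incP4_eq (m1 m2 : Option (Fin 2)) (x3 x4 : Fin 2) :
    incP4 m1 m2 x3 x4 = if x3 = 0 then (incPre3 m1 m2 (0, x4) (0, x4)).re else 0 := by
  simp only [incP4, incFinal, Matrix.trace, Matrix.diag_apply, Fintype.sum_prod_type,
    measSys_apply, CNOTE_conj, incPre3_apply]
  fin_cases x3 <;> fin_cases x4 <;> simp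

lemma incP3_eq (m1 m2 : Option (Fin 2)) (x3 : Fin 2) :
    incP3 m1 m2 x3 = if x3 = 0 then
      (incPre3 m1 m2 (0, 0) (0, 0)).re + (incPre3 m1 m2 (0, 1) (0, 1)).re else 0 := by
  simp only [incP3, Matrix.trace, Matrix.diag_apply, Fintype.sum_prod_type,
    measSys_apply, incPre3_apply]
  fin_cases x3 <;> simp

lemma pre_ss (x1 x2 e : Fin 2) :
    incPre3 (some x1) (some x2) (0, e) (0, e) = 1 / 8 := by
  simp only [incPre3_apply, Hsys_apply, optMeasSys, Option.elim, measSys_apply, phi0_apply]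
  fin_cases x1 <;> fin_cases x2 <;> fin_cases e <;> simp [sg] <;> norm_num

lemma pre_sn (x1 e : Fin 2) :
    incPre3 (some x1) none (0, e) (0, e) = if e = 0 then 1 / 2 else 0 := by
  simp only [incPre3_apply, Hsys_apply, optMeasSys, Option.elim, measSys_apply, phi0_apply]
  fin_cases x1 <;> fin_cases e <;> simp [sg] <;> norm_num

lemma pre_ns (x2 e : Fin 2) :
    incPre3 none (some x2) (0, e) (0, e) = 1 / 4 := by
  simp only [incPre3_apply, Hsys_apply, optMeasSys, Option.elim, measSys_apply, phi0_apply]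
  fin_cases x2 <;> fin_cases e <;> simp [sg] <;> norm_num

lemma p2_ss (x1 x2 : Fin 2) : incP2 (some x1) (some x2) = 1 / 4 := by
  simp only [incP2, Matrix.trace, Matrix.diag_apply, Fintype.sum_prod_type, Hsys_apply,
    optMeasSys, Option.elim, measSys_apply, phi0_apply]
  fin_cases x1 <;> fin_cases x2 <;> simp [sg] <;> norm_num

lemma p2_sn (x1 : Fin 2) : incP2 (some x1) none = 1 / 2 := by
  simp only [incP2, Matrix.trace, Matrix.diag_apply, Fintype.sum_prod_type, Hsys_apply,
    optMeasSys, Option.elim, measSys_apply, phi0_apply]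
  fin_cases x1 <;> simp [sg] <;> norm_num

lemma p2_ns (x2 : Fin 2) : incP2 none (some x2) = 1 / 2 := by
  simp only [incP2, Matrix.trace, Matrix.diag_apply, Fintype.sum_prod_type, Hsys_apply,
    optMeasSys, Option.elim, measSys_apply, phi0_apply]
  fin_cases x2 <;> simp [sg] <;> norm_num

/-- For the incompatible-statistics circuit, all recorded conditional probabilities
are Markovian yet mutually incompatible: whenever the conditioning probabilities are
positive, `P(x₄|x₃,x₂,x₁) = 1/2` if `x₃ = 0` (independent of `x₂, x₁`),
`P(x₄|x₃,𝓘₂,x₁) = 1` if `x₃ = 0 ∧ x₄ = 0` and `0` otherwise (independent of `x₁`),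
`P(x₄|x₃,x₂,𝓘₁) = 1/2` if `x₃ = 0` (independent of `x₂`), and
`P(x₃|x₂,x₁) = P(x₃|𝓘₂,x₁) = P(x₃|x₂,𝓘₁) = 1` if `x₃ = 0` and `0` otherwise; in
particular `P(x₄|x₃,x₂,x₁) ≠ P(x₄|x₃,𝓘₂,x₁)` for `x₃ = 0`, so the Markovian
conditional probabilities at `t₄` depend on whether a measurement was performed
at `t₂`. -/
theorem inc_markov_but_incompatible :
    (∀ x1 x2 x3 x4 : Fin 2, 0 < incP3 (some x1) (some x2) x3 → x3 = 0 →
      incP4 (some x1) (some x2) x3 x4 / incP3 (some x1) (some x2) x3 = 1 / 2) ∧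
    (∀ x1 x3 x4 : Fin 2, 0 < incP3 (some x1) none x3 →
      incP4 (some x1) none x3 x4 / incP3 (some x1) none x3 =
        if x3 = 0 ∧ x4 = 0 then 1 else 0) ∧
    (∀ x2 x3 x4 : Fin 2, 0 < incP3 none (some x2) x3 → x3 = 0 →
      incP4 none (some x2) x3 x4 / incP3 none (some x2) x3 = 1 / 2) ∧
    (∀ x1 x2 x3 : Fin 2, 0 < incP2 (some x1) (some x2) →
      incP3 (some x1) (some x2) x3 / incP2 (some x1) (some x2) =
        if x3 = 0 then 1 else 0) ∧
    (∀ x1 x3 : Fin 2, 0 < incP2 (some x1) none →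
      incP3 (some x1) none x3 / incP2 (some x1) none =
        if x3 = 0 then 1 else 0) ∧
    (∀ x2 x3 : Fin 2, 0 < incP2 none (some x2) →
      incP3 none (some x2) x3 / incP2 none (some x2) =
        if x3 = 0 then 1 else 0) ∧
    (∃ x1 x2 x4 : Fin 2,
      0 < incP3 (some x1) (some x2) 0 ∧ 0 < incP3 (some x1) none 0 ∧
      incP4 (some x1) (some x2) 0 x4 / incP3 (some x1) (some x2) 0 ≠
        incP4 (some x1) none 0 x4 / incP3 (some x1) none 0) := by
  simp only [incP4_eq, incP3_eq, pre_ss, pre_sn, pre_ns, p2_ss, p2_sn, p2_ns]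
  refine ⟨?_, ?_, ?_, ?_, ?_, ?_, ⟨0, 0, 0, ?_⟩⟩
  · intro x1 x2 x3 x4 _ h
    subst h
    norm_num
  · intro x1 x3 x4 _
    fin_cases x3 <;> fin_cases x4 <;> simp
  · intro x2 x3 x4 _ h
    subst h
    norm_num
  · intro x1 x2 x3 _
    fin_cases x3 <;> norm_num
  · intro x1 x3 _
    fin_cases x3 <;> norm_num
  · intro x2 x3 _
    fin_cases x3 <;> norm_num
  · norm_num
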